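/- The six symmetric expressions a+e, a·e, b+f, b·f, c+d, c·d all lie in the subfield of K = ℚ(a,b,c,d,e,f) generated over ℚ by the six line coordinates s_1, t_1, s_2, t_2, s_3, t_3 of the three Pascal lines ℓ_1, ℓ_2, ℓ_3. -/

import Mathlib

noncomputable section

/-- `K = ℚ(a,b,c,d,e,f)`, the field of rational functions in six variables over ℚ. -/
abbrev RatField : Type := FractionRing (MvPolynomial (Fin 6) ℚ)

/-- The six independent variables `a, b, c, d, e, f` (indexed `0,…,5`) as elements of
`ℚ(a,…,f)`. -/
def var (i : Fin 6) : RatField :=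
  algebraMap (MvPolynomial (Fin 6) ℚ) RatField (MvPolynomial.X i)

/-- The point `[1, p, p²]` of the conic `z1² = z0·z2`, in homogeneous coordinates. -/
def conicPt (p : RatField) : Fin 3 → RatField := ![1, p, p ^ 2]

/-- Cross product of coordinate vectors: the coordinates of the join of two points, or of
the intersection of two lines. -/
def cross (u v : Fin 3 → RatField) : Fin 3 → RatField :=
  ![u 1 * v 2 - u 2 * v 1, u 2 * v 0 - u 0 * v 2, u 0 * v 1 - u 1 * v 0]

/-- The homogeneous coordinate vector of the Pascal line of the array
`[P1 P2 P3; Q1 Q2 Q3]` of points of the conic with parameters `p1, p2, p3, q1, q2, q3`: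
the line through the (collinear) points `P1Q2 ∩ P2Q1`, `P2Q3 ∩ P3Q2`, `P1Q3 ∩ P3Q1`,
computed as the join of the first two of them. -/
def pascalVec (p1 p2 p3 q1 q2 q3 : RatField) : Fin 3 → RatField :=
  cross
    (cross (cross (conicPt p1) (conicPt q2)) (cross (conicPt p2) (conicPt q1)))
    (cross (cross (conicPt p2) (conicPt q3)) (cross (conicPt p3) (conicPt q2)))

/-- The coordinate `s` of a line with coordinates `⟨1, s, t⟩`, i.e. the line
`z0 + s·z1 + t·z2 = 0`. -/
def sCoord (l : Fin 3 → RatField) : RatField := l 1 / l 0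

/-- The coordinate `t` of a line with coordinates `⟨1, s, t⟩`, i.e. the line
`z0 + s·z1 + t·z2 = 0`. -/
def tCoord (l : Fin 3 → RatField) : RatField := l 2 / l 0

/-- The Pascal `ℓ₁` of the array `[A D B; E C F]`. -/
def line1 : Fin 3 → RatField := pascalVec (var 0) (var 3) (var 1) (var 4) (var 2) (var 5)

/-- The Pascal `ℓ₂` of the array `[A C F; E D B]`. -/
def line2 : Fin 3 → RatField := pascalVec (var 0) (var 2) (var 5) (var 4) (var 3) (var 1)

/-- The Pascal `ℓ₃` of the array `[A D F; E C B]`. -/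
def line3 : Fin 3 → RatField := pascalVec (var 0) (var 3) (var 5) (var 4) (var 2) (var 1)

/-- The Pascal `ℓ⋆` of the array `[A B C; F D E]`. -/
def lineStar : Fin 3 → RatField :=
  pascalVec (var 0) (var 1) (var 2) (var 5) (var 3) (var 4)

/-- The symmetric bilinear form polarizing twice the quadratic form `z1² - z0·z2`. -/
def polar (u v : Fin 3 → RatField) : RatField := 2 * (u 1 * v 1) - u 0 * v 2 - u 2 * v 0

/-- The pole of the chord joining the points of the conic with parameters `p` and `q`,
scaled so that `polar` takes the value `2` on it. -/
def chordPole (p q : RatField) : Fin 3 → RatField :=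
  ![2 / (p - q), (p + q) / (p - q), 2 * (p * q) / (p - q)]

theorem polar_chordPole {p q : RatField} (h : p ≠ q) :
    polar (chordPole p q) (chordPole p q) = 2 := by
  have h' : p - q ≠ 0 := sub_ne_zero.2 h
  simp [polar, chordPole]
  field_simp
  ring

theorem chordPole_swap (p q : RatField) : chordPole q p = -chordPole p q := by
  have h (r : RatField) : r / (q - p) = -(r / (p - q)) := by rw [← neg_sub, div_neg]
  ext i
  fin_cases i <;> simp [chordPole, h] <;> ring

theorem cross_smul_smul (r s : RatField) (u v : Fin 3 → RatField) :
    cross (r • u) (s • v) = (r * s) • cross u v := by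
  ext i
  fin_cases i <;> simp [cross] <;> ring

theorem polar_smul_smul (r s : RatField) (u v : Fin 3 → RatField) :
    polar (r • u) (s • v) = (r * s) * polar u v := by
  simp [polar]
  ring

/-- The intersection of the chords `p1q2` and `p2q1`. -/
def chordMeet {R : Type*} [CommRing R] (p1 p2 q1 q2 : R) : Fin 3 → R :=
  ![q1 + p2 - p1 - q2, p2 * q1 - p1 * q2, (p1 + q2) * (p2 * q1) - p1 * q2 * (p2 + q1)]

theorem cross_cross_conicPt (p1 p2 q1 q2 : RatField) :
    cross (cross (conicPt p1) (conicPt q2)) (cross (conicPt p2) (conicPt q1)) =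
      ((q2 - p1) * (q1 - p2)) • chordMeet p1 p2 q1 q2 := by
  ext i
  fin_cases i <;> simp [cross, conicPt, chordMeet] <;> ring

theorem pascalVec_eq_smul_cross_chordMeet (p1 p2 p3 q1 q2 q3 : RatField) :
    pascalVec p1 p2 p3 q1 q2 q3 =
      ((q2 - p1) * (q1 - p2) * ((q3 - p2) * (q2 - p3))) •
        cross (chordMeet p1 p2 q1 q2) (chordMeet p2 p3 q2 q3) := by
  rw [pascalVec, cross_cross_conicPt, cross_cross_conicPt, cross_smul_smul]

theorem chordMeet_eq_smul {p1 p2 q1 q2 : RatField} (h1 : p1 ≠ q1) (h2 : p2 ≠ q2) :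
    chordMeet p1 p2 q1 q2 =
      ((p1 - q1) * (p2 - q2) / 2) • (chordPole p1 q1 - chordPole p2 q2) := by
  have h1' : p1 - q1 ≠ 0 := sub_ne_zero.2 h1
  have h2' : p2 - q2 ≠ 0 := sub_ne_zero.2 h2
  ext i
  fin_cases i <;> simp [chordMeet, chordPole] <;> field_simp <;> ring

theorem exists_pascalVec_eq_smul {p1 p2 p3 q1 q2 q3 : RatField} (h1 : p1 ≠ q1) (h2 : p2 ≠ q2)
    (h3 : p3 ≠ q3) :
    ∃ m : RatField, pascalVec p1 p2 p3 q1 q2 q3 =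
      m • cross (chordPole p1 q1 - chordPole p2 q2) (chordPole p2 q2 - chordPole p3 q3) := by
  rw [pascalVec_eq_smul_cross_chordMeet, chordMeet_eq_smul h1 h2, chordMeet_eq_smul h2 h3,
    cross_smul_smul, smul_smul]
  exact ⟨_, rfl⟩

/-- The determinant of three coordinate vectors. -/
def tripleDet (x y z : Fin 3 → RatField) : RatField :=
  x 0 * cross y z 0 + x 1 * cross y z 1 + x 2 * cross y z 2

/-- The intersection of the lines `l2` and `l3`, weighted by the conic so that it is
homogeneous of the same degree in `l1`, `l2` and `l3`. -/
def weightedMeet (l1 l2 l3 : Fin 3 → RatField) : Fin 3 → RatField :=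
  polar (cross l3 l1) (cross l1 l2) • cross l2 l3

theorem weightedMeet_smul (r s t : RatField) (l1 l2 l3 : Fin 3 → RatField) :
    weightedMeet (r • l1) (s • l2) (t • l3) = ((r * s * t) ^ 2) • weightedMeet l1 l2 l3 := by
  simp only [weightedMeet, cross_smul_smul, polar_smul_smul, smul_smul]
  congr 1
  ring

theorem cross_pascal_two_three (x y z : Fin 3 → RatField) :
    cross (cross (x + y) (z - y)) (cross (x - y) (y + z)) =
    (-(2 * tripleDet x y z)) • (x + z) := by
  ext i
  fin_cases i <;> simp [cross, tripleDet] <;> ring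

theorem cross_pascal_three_one (x y z : Fin 3 → RatField) :
    cross (cross (x - y) (y + z)) (cross (x - y) (y - z)) =
    (-(2 * tripleDet x y z)) • (x - y) := by
  ext i
  fin_cases i <;> simp [cross, tripleDet] <;> ring

theorem cross_pascal_one_two (x y z : Fin 3 → RatField) :
    cross (cross (x - y) (y - z)) (cross (x + y) (z - y)) =
    (2 * tripleDet x y z) • (y - z) := by
  ext i
  fin_cases i <;> simp [cross, tripleDet] <;> ring

theorem weightedMeet_pascal {x y z : Fin 3 → RatField} (hxy : polar x x = polar y y)
    (hyz : polar y y = polar z z) {v1 v2 v3 : Fin 3 → RatField}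
    (h1 : v1 = cross (x - y) (y - z)) (h2 : v2 = cross (x + y) (z - y))
    (h3 : v3 = cross (x - y) (y + z)) {k : RatField}
    (hk : k = (2 * tripleDet x y z) ^ 3 * polar (x - y) (y - z)) :
    weightedMeet v1 v2 v3 = k • (x + z) ∧ weightedMeet v2 v3 v1 = k • (x - y) ∧
      weightedMeet v3 v1 v2 = k • (z - y) := by
  have e2 : polar (y - z) (x + z) = polar (x - y) (y - z) := by
    simp only [polar, Pi.add_apply, Pi.sub_apply] at *
    linear_combination hyz
  have e3 : polar (x + z) (x - y) = -polar (x - y) (y - z) := by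
    simp only [polar, Pi.add_apply, Pi.sub_apply] at *
    linear_combination hxy
  subst h1 h2 h3 hk
  simp only [weightedMeet, cross_pascal_two_three, cross_pascal_three_one,
    cross_pascal_one_two, polar_smul_smul, smul_smul, e2, e3]
  refine ⟨by congr 1; ring, by congr 1; ring, ?_⟩
  rw [← neg_sub y z, smul_neg, ← neg_smul]
  congr 1
  ring

section Subfield

variable {S : Subfield RatField}

theorem cross_mem {u v : Fin 3 → RatField} (hu : ∀ i, u i ∈ S) (hv : ∀ i, v i ∈ S) (i : Fin 3) :
    cross u v i ∈ S := by
  have h (i j k l) : u i * v j - u k * v l ∈ S :=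
    S.sub_mem (S.mul_mem (hu i) (hv j)) (S.mul_mem (hu k) (hv l))
  fin_cases i <;> exact h _ _ _ _

theorem polar_mem {u v : Fin 3 → RatField} (hu : ∀ i, u i ∈ S) (hv : ∀ i, v i ∈ S) :
    polar u v ∈ S :=
  S.sub_mem (S.sub_mem (S.mul_mem (ofNat_mem S 2) (S.mul_mem (hu 1) (hv 1)))
    (S.mul_mem (hu 0) (hv 2))) (S.mul_mem (hu 2) (hv 0))

theorem weightedMeet_mem {l1 l2 l3 : Fin 3 → RatField} (h1 : ∀ i, l1 i ∈ S)
    (h2 : ∀ i, l2 i ∈ S) (h3 : ∀ i, l3 i ∈ S) (i : Fin 3) : weightedMeet l1 l2 l3 i ∈ S :=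
  S.mul_mem (polar_mem (cross_mem h3 h1) (cross_mem h1 h2)) (cross_mem h2 h3 i)

theorem exists_smul_mem_of_pascal {x y z : Fin 3 → RatField} (hxy : polar x x = polar y y)
    (hyz : polar y y = polar z z) (hD : tripleDet x y z ≠ 0) (hg : polar (x - y) (y - z) ≠ 0)
    {m1 m2 m3 : RatField} (hm1 : m1 ≠ 0) (hm2 : m2 ≠ 0) (hm3 : m3 ≠ 0)
    (h1 : ∀ i, (m1 • cross (x - y) (y - z)) i ∈ S) (h2 : ∀ i, (m2 • cross (x + y) (z - y)) i ∈ S)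
    (h3 : ∀ i, (m3 • cross (x - y) (y + z)) i ∈ S) :
    ∃ k : RatField, k ≠ 0 ∧ (∀ i, k * x i ∈ S) ∧ (∀ i, k * y i ∈ S) ∧ ∀ i, k * z i ∈ S := by
  obtain ⟨w1, w2, w3⟩ := weightedMeet_pascal hxy hyz rfl rfl rfl rfl
  have k1 := weightedMeet_mem h1 h2 h3
  have k2 := weightedMeet_mem h2 h3 h1
  have k3 := weightedMeet_mem h3 h1 h2
  rw [weightedMeet_smul] at k1 k2 k3
  rw [w1] at k1
  rw [w2] at k2
  rw [w3] at k3
  simp only [Pi.smul_apply, Pi.add_apply, Pi.sub_apply, smul_eq_mul] at k1 k2 k3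
  refine ⟨2 * (m1 * m2 * m3) ^ 2 * ((2 * tripleDet x y z) ^ 3 * polar (x - y) (y - z)),
    by simp [*], fun i => ?_, fun i => ?_, fun i => ?_⟩
  · convert S.sub_mem (S.add_mem (k1 i) (k2 i)) (k3 i) using 1
    ring
  · convert S.sub_mem (S.sub_mem (k1 i) (k2 i)) (k3 i) using 1
    ring
  · convert S.add_mem (S.sub_mem (k1 i) (k2 i)) (k3 i) using 1
    ring

theorem add_mem_and_mul_mem_of_chordPole {p q k : RatField} (hpq : p ≠ q) (hk : k ≠ 0)
    (h : ∀ i, k * chordPole p q i ∈ S) : p + q ∈ S ∧ p * q ∈ S := by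
  have hpq' : p - q ≠ 0 := sub_ne_zero.2 hpq
  constructor
  · convert S.mul_mem (ofNat_mem S 2) (S.div_mem (h 1) (h 0)) using 1
    simp [chordPole]
    field_simp
  · convert S.div_mem (h 2) (h 0) using 1
    simp [chordPole]
    field_simp

theorem normalized_mem {l : Fin 3 → RatField} (hl : l 0 ≠ 0) (hs : sCoord l ∈ S)
    (ht : tCoord l ∈ S) (i : Fin 3) : ((l 0)⁻¹ • l) i ∈ S := by
  fin_cases i
  · simp [hl]
  · simpa [sCoord, div_eq_inv_mul] using hs
  · simpa [tCoord, div_eq_inv_mul] using ht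

end Subfield

theorem exists_ne_zero_smul_eq_normalized {l v : Fin 3 → RatField} (hl : l 0 ≠ 0)
    (h : ∃ m : RatField, l = m • v) : ∃ m : RatField, m ≠ 0 ∧ (l 0)⁻¹ • l = m • v := by
  obtain ⟨m, rfl⟩ := h
  refine ⟨((m • v) 0)⁻¹ * m, mul_ne_zero (inv_ne_zero hl) ?_, smul_smul _ _ _⟩
  rintro rfl
  simp at hl

theorem var_injective : Function.Injective var :=
  (IsFractionRing.injective (MvPolynomial (Fin 6) ℚ) RatField).comp MvPolynomial.X_injective

theorem algebraMap_ne_zero_of_eval {P : MvPolynomial (Fin 6) ℚ} (x : Fin 6 → ℚ)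
    (h : MvPolynomial.eval x P ≠ 0) : algebraMap (MvPolynomial (Fin 6) ℚ) RatField P ≠ 0 := by
  rw [Ne, FaithfulSMul.algebraMap_eq_zero_iff]
  rintro rfl
  simp at h

/-- The leading coordinate of the join of two of the three intersection points of chords. -/
def pascalLead {R : Type*} [CommRing R] (p1 p2 p3 q1 q2 q3 : R) : R :=
  (q2 - p1) * (q1 - p2) * ((q3 - p2) * (q2 - p3)) *
    (chordMeet p1 p2 q1 q2 1 * chordMeet p2 p3 q2 q3 2 -
      chordMeet p1 p2 q1 q2 2 * chordMeet p2 p3 q2 q3 1)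

theorem pascalVec_zero (p1 p2 p3 q1 q2 q3 : RatField) :
    pascalVec p1 p2 p3 q1 q2 q3 0 = pascalLead p1 p2 p3 q1 q2 q3 := by
  rw [pascalVec_eq_smul_cross_chordMeet]
  rfl

theorem pascalLead_map {R T : Type*} [CommRing R] [CommRing T] (φ : R →+* T)
    (p1 p2 p3 q1 q2 q3 : R) :
    φ (pascalLead p1 p2 p3 q1 q2 q3) =
      pascalLead (φ p1) (φ p2) (φ p3) (φ q1) (φ q2) (φ q3) := by
  simp [pascalLead, chordMeet]

theorem pascalVec_var_zero_ne_zero (x : Fin 6 → ℚ) (i1 i2 i3 j1 j2 j3 : Fin 6)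
    (h : pascalLead (x i1) (x i2) (x i3) (x j1) (x j2) (x j3) ≠ 0) :
    pascalVec (var i1) (var i2) (var i3) (var j1) (var j2) (var j3) 0 ≠ 0 := by
  simp only [pascalVec_zero, var, ← pascalLead_map]
  refine algebraMap_ne_zero_of_eval x ?_
  simpa only [pascalLead_map, MvPolynomial.eval_X] using h

theorem tripleDet_chordPole_ne_zero :
    tripleDet (chordPole (var 0) (var 4)) (chordPole (var 3) (var 2))
      (chordPole (var 1) (var 5)) ≠ 0 := by
  have h1 : var 0 - var 4 ≠ 0 := sub_ne_zero.2 (var_injective.ne (by decide))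
  have h2 : var 3 - var 2 ≠ 0 := sub_ne_zero.2 (var_injective.ne (by decide))
  have h3 : var 1 - var 5 ≠ 0 := sub_ne_zero.2 (var_injective.ne (by decide))
  have key : ((var 3 + var 2) - (var 0 + var 4)) * (var 1 * var 5 - var 0 * var 4) -
      ((var 1 + var 5) - (var 0 + var 4)) * (var 3 * var 2 - var 0 * var 4) ≠ 0 := by
    simp only [var, ← map_add, ← map_sub, ← map_mul]
    exact algebraMap_ne_zero_of_eval ![0, 1, 3, 7, 0, 12] (by simp; norm_num)
  intro h
  apply key
  simp [tripleDet, cross, chordPole] at h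
  field_simp at h
  linear_combination h / 4

theorem polar_chordPole_sub_ne_zero :
    polar (chordPole (var 0) (var 4) - chordPole (var 3) (var 2))
      (chordPole (var 3) (var 2) - chordPole (var 1) (var 5)) ≠ 0 := by
  have h1 : var 0 ≠ var 4 := var_injective.ne (by decide)
  have h2 : var 3 ≠ var 2 := var_injective.ne (by decide)
  have h3 : var 1 ≠ var 5 := var_injective.ne (by decide)
  have key : polar (chordMeet (var 0) (var 3) (var 4) (var 2))
      (chordMeet (var 3) (var 1) (var 2) (var 5)) ≠ 0 := by
    simp only [polar, chordMeet, var, Matrix.cons_val, ← map_add, ← map_sub, ← map_mul,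
      ← map_ofNat (algebraMap (MvPolynomial (Fin 6) ℚ) RatField) 2]
    exact algebraMap_ne_zero_of_eval ![0, 1, 3, 7, 5, 12] (by simp; norm_num)
  rw [chordMeet_eq_smul h1 h2, chordMeet_eq_smul h2 h3, polar_smul_smul] at key
  exact right_ne_zero_of_mul key

/-- The six symmetric expressions `a+e, a·e, b+f, b·f, c+d, c·d` all lie in the subfield
of `K = ℚ(a,…,f)` generated over ℚ by the six line coordinates `s₁, t₁, s₂, t₂, s₃, t₃`
of the three Pascal lines `ℓ₁, ℓ₂, ℓ₃`. -/
theorem pascal_stmt_1 :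
    var 0 + var 4 ∈ Subfield.closure
        {sCoord line1, tCoord line1, sCoord line2, tCoord line2,
          sCoord line3, tCoord line3} ∧
      var 0 * var 4 ∈ Subfield.closure
        {sCoord line1, tCoord line1, sCoord line2, tCoord line2,
          sCoord line3, tCoord line3} ∧
      var 1 + var 5 ∈ Subfield.closure
        {sCoord line1, tCoord line1, sCoord line2, tCoord line2,
          sCoord line3, tCoord line3} ∧
      var 1 * var 5 ∈ Subfield.closure
        {sCoord line1, tCoord line1, sCoord line2, tCoord line2,
          sCoord line3, tCoord line3} ∧
      var 2 + var 3 ∈ Subfield.closure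
        {sCoord line1, tCoord line1, sCoord line2, tCoord line2,
          sCoord line3, tCoord line3} ∧
      var 2 * var 3 ∈ Subfield.closure
        {sCoord line1, tCoord line1, sCoord line2, tCoord line2,
          sCoord line3, tCoord line3} := by
  have h1 : var 0 ≠ var 4 := var_injective.ne (by decide)
  have h2 : var 3 ≠ var 2 := var_injective.ne (by decide)
  have h3 : var 1 ≠ var 5 := var_injective.ne (by decide)
  have hl1 : line1 0 ≠ 0 :=
    pascalVec_var_zero_ne_zero ![0, 1, 3, 7, 5, 12] _ _ _ _ _ _
      (by simp [pascalLead, chordMeet]; norm_num)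
  have hl2 : line2 0 ≠ 0 :=
    pascalVec_var_zero_ne_zero ![0, 1, 3, 7, 5, 12] _ _ _ _ _ _
      (by simp [pascalLead, chordMeet]; norm_num)
  have hl3 : line3 0 ≠ 0 :=
    pascalVec_var_zero_ne_zero ![0, 1, 3, 7, 5, 12] _ _ _ _ _ _
      (by simp [pascalLead, chordMeet]; norm_num)
  obtain ⟨m1, hm1, e1⟩ :=
    exists_ne_zero_smul_eq_normalized hl1 (exists_pascalVec_eq_smul h1 h2 h3)
  obtain ⟨m2, hm2, e2⟩ :=
    exists_ne_zero_smul_eq_normalized hl2 (exists_pascalVec_eq_smul h1 h2.symm h3.symm)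
  obtain ⟨m3, hm3, e3⟩ :=
    exists_ne_zero_smul_eq_normalized hl3 (exists_pascalVec_eq_smul h1 h2 h3.symm)
  rw [chordPole_swap (var 3), chordPole_swap (var 1), sub_neg_eq_add, neg_sub_neg] at e2
  rw [chordPole_swap (var 1), sub_neg_eq_add] at e3
  set S := Subfield.closure
        {sCoord line1, tCoord line1, sCoord line2, tCoord line2,
          sCoord line3, tCoord line3}
  have hmem : {sCoord line1, tCoord line1, sCoord line2, tCoord line2,
      sCoord line3, tCoord line3} ⊆ (S : Set RatField) := Subfield.subset_closure
  simp only [Set.insert_subset_iff, Set.singleton_subset_iff, SetLike.mem_coe] at hmem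
  obtain ⟨s1, t1, s2, t2, s3, t3⟩ := hmem
  obtain ⟨k, hk, kx, ky, kz⟩ := exists_smul_mem_of_pascal
    ((polar_chordPole h1).trans (polar_chordPole h2).symm)
    ((polar_chordPole h2).trans (polar_chordPole h3).symm)
    tripleDet_chordPole_ne_zero polar_chordPole_sub_ne_zero hm1 hm2 hm3
    (e1 ▸ normalized_mem hl1 s1 t1) (e2 ▸ normalized_mem hl2 s2 t2)
    (e3 ▸ normalized_mem hl3 s3 t3)
  obtain ⟨ax, bx⟩ := add_mem_and_mul_mem_of_chordPole h1 hk kx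
  obtain ⟨ay, cy⟩ := add_mem_and_mul_mem_of_chordPole h2 hk ky
  obtain ⟨az, cz⟩ := add_mem_and_mul_mem_of_chordPole h3 hk kz
  exact ⟨ax, bx, az, cz, add_comm (var 3) (var 2) ▸ ay, mul_comm (var 3) (var 2) ▸ cy⟩

end
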